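/- arXiv:2412.20513 — 4 statements merged into one kernel-verified Lean document; each statement's English description precedes it below -/
import Mathlib

section
/- Let a, b > 2 be integers with a odd and b odd, n = a + b − 1, and suppose b > 2a. Let W be the weighted signless edge-vertex incidence matrix of the graph ET(n, a, b). Then min { ‖G‖_{∞,∞} : G ∈ ℝ^{n×(n+1)}, W G W = W } = b. -/
/-- The `(∞,∞)` operator norm of a real matrix: the maximal absolute row sum. -/
noncomputable def matInfNorm {m n : Type*} [Fintype m] [Fintype n]
    (A : Matrix m n ℝ) : ℝ := ⨆ i, ∑ j, |A i j|


/-- The weighted signless edge-vertex incidence matrix `W = B D⁻¹` of the bicyclic graph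
`ET(n, a, b)` with `n = a + b - 1` vertices `v_1, …, v_n` and `n + 1 = a + b` edges
`e_1, …, e_{n+1}`, where `e_k` joins `v_k` and `v_{k+1}` for `k = 1, …, a-1`; `e_a` joins
`v_a` and `v_1`; `e_k` joins `v_{k-1}` and `v_k` for `k = a+1, …, n`; and `e_{n+1}` joins
`v_n` and `v_a`. Rows are indexed by edges (edge `e_k` corresponds to index `k - 1` in
`Fin (a + b)`), columns by vertices (vertex `v_j` corresponds to index `j - 1` in
`Fin (a + b - 1)`); the entry in row `e_k`, column `v_j` is `1 / deg v_j` if `v_j` is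
incident to `e_k`, and `0` otherwise (the degree of `v_a` is `4`, all other degrees are `2`). -/
noncomputable def ETW (a b : ℕ) : Matrix (Fin (a + b)) (Fin (a + b - 1)) ℝ :=
  fun k j =>
    let n := a + b - 1
    let K := (k : ℕ) + 1
    let J := (j : ℕ) + 1
    let u : ℕ := if K ≤ a - 1 then K else if K = a then a else if K ≤ n then K - 1 else n
    let v : ℕ := if K ≤ a - 1 then K + 1 else if K = a then 1 else if K ≤ n then K else a
    if J = u ∨ J = v then (if J = a then (4 : ℝ)⁻¹ else (2 : ℝ)⁻¹) else 0

/-- The alternating sign `(-1) ^ n`. -/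
def altSign (n : ℕ) : ℝ := if n % 2 = 0 then 1 else -1

/-- A left inverse of `ETW a b`, each of whose rows is supported on a single cycle. -/
def ETWLeftInv (a b : ℕ) : Matrix (Fin (a + b - 1)) (Fin (a + b)) ℝ :=
  fun j k =>
    if (j : ℕ) < a then
      if a ≤ (k : ℕ) then 0
      else (if (j : ℕ) = a - 1 then 2 else 1) *
        (if (k : ℕ) = a - 1 then altSign j
          else if (k : ℕ) < j then altSign (k + j + 1) else altSign (k + j))
    else
      if (k : ℕ) < a then 0
      else if (k : ℕ) ≤ j then altSign (k + j) else altSign (k + j + 1)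

lemma abs_altSign (n : ℕ) : |altSign n| = 1 := by
  unfold altSign; split_ifs <;> simp

lemma sum_mul_of_support_pair {ι : Type*} [Fintype ι] [DecidableEq ι] (g f : ι → ℝ) {x y : ι}
    (hxy : x ≠ y) (hf : ∀ k, k ≠ x → k ≠ y → f k = 0) :
    ∑ k, g k * f k = g x * f x + g y * f y := by
  rw [← Finset.sum_subset (Finset.subset_univ {x, y}), Finset.sum_pair hxy]
  intro k _ hk
  simp only [Finset.mem_insert, Finset.mem_singleton, not_or] at hk
  rw [hf k hk.1 hk.2, mul_zero]

lemma ETW_row_sum {a b : ℕ} (ha : 2 < a) (hb : 2 < b) (w : ℕ → ℝ) (k : Fin (a + b)) :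
    ∑ p : Fin (a + b - 1), (if (p : ℕ) = a - 1 then 4 else 2) * w p * ETW a b k p =
      if (k : ℕ) < a - 1 then w k + w (k + 1)
      else if (k : ℕ) = a - 1 then w (a - 1) + w 0
      else if (k : ℕ) < a + b - 1 then w (k - 1) + w k
      else w (a + b - 2) + w (a - 1) := by
  have key : ∀ x y : ℕ, ∀ hx : x < a + b - 1, ∀ hy : y < a + b - 1, x ≠ y →
      (∀ p : Fin (a + b - 1), ETW a b k p =
        if (p : ℕ) = x ∨ (p : ℕ) = y then (if (p : ℕ) = a - 1 then (4 : ℝ)⁻¹ else 2⁻¹) else 0) →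
      ∑ p : Fin (a + b - 1), (if (p : ℕ) = a - 1 then 4 else 2) * w p * ETW a b k p
        = w x + w y := by
    intro x y hx hy hxy h
    rw [sum_mul_of_support_pair _ _ (x := ⟨x, hx⟩) (y := ⟨y, hy⟩) (by simpa using hxy)]
    · simp only [h, true_or, or_true, if_true]
      congr 1 <;> split_ifs <;> ring
    · intro p h1 h2
      rw [h, if_neg]
      rintro (h3 | h3)
      · exact h1 (Fin.ext h3)
      · exact h2 (Fin.ext h3)
  have hk := k.isLt
  split_ifs with h1 h2 h3
  all_goals
    apply key
    · omega
    · omega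
    · omega
    · intro p
      have hp := p.isLt
      simp only [ETW]
      split_ifs <;> first | rfl | omega

lemma ETW_column_sum {a b : ℕ} (ha : 2 < a) (hb : 2 < b) (g : Fin (a + b) → ℝ)
    (p : Fin (a + b - 1)) (hp : (p : ℕ) ≠ a - 1) :
    ∑ k, g k * ETW a b k p =
      (if h : (p : ℕ) < a then
        g ⟨p, by omega⟩ + g ⟨if (p : ℕ) = 0 then a - 1 else p - 1, by split_ifs <;> omega⟩
      else g ⟨p, by omega⟩ + g ⟨p + 1, by omega⟩) / 2 := by
  have key : ∀ x y : Fin (a + b), x ≠ y →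
      (∀ k : Fin (a + b), ETW a b k p =
        if (k : ℕ) = x ∨ (k : ℕ) = y then 2⁻¹ else 0) →
      ∑ k, g k * ETW a b k p = (g x + g y) / 2 := by
    intro x y hxy h
    rw [sum_mul_of_support_pair _ _ hxy]
    · simp only [h, true_or, or_true, if_true]
      ring
    · intro k h1 h2
      rw [h, if_neg]
      rintro (h3 | h3)
      · exact h1 (Fin.ext h3)
      · exact h2 (Fin.ext h3)
  have hpl := p.isLt
  split_ifs with h1 h2
  all_goals
    apply key
    · simp only [ne_eq, Fin.mk.injEq]; omega
    · intro k
      have hk := k.isLt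
      simp only [ETW]
      split_ifs <;> first | rfl | omega

lemma ETW_column_sum_center {a b : ℕ} (ha : 2 < a) (hb : 2 < b) (g : Fin (a + b) → ℝ)
    (p : Fin (a + b - 1)) (hp : (p : ℕ) = a - 1) :
    ∑ k, g k * ETW a b k p =
      (g ⟨a - 2, by omega⟩ + g ⟨a - 1, by omega⟩ + g ⟨a, by omega⟩
        + g ⟨a + b - 1, by omega⟩) / 4 := by
  have h : ∀ k : Fin (a + b), g k * ETW a b k p =
      (if k = ⟨a - 2, by omega⟩ then g k / 4 else 0) +
      (if k = ⟨a - 1, by omega⟩ then g k / 4 else 0) +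
      (if k = ⟨a, by omega⟩ then g k / 4 else 0) +
      (if k = ⟨a + b - 1, by omega⟩ then g k / 4 else 0) := by
    intro k
    have hk := k.isLt
    simp only [ETW, Fin.ext_iff]
    split_ifs <;> first | omega | ring
  simp only [h, Finset.sum_add_distrib, Finset.sum_ite_eq', Finset.mem_univ, if_true]
  ring

lemma ETWLeftInv_center_sum {a b : ℕ} (ha : 2 < a) (hb : 2 < b) (haodd : Odd a) (hbodd : Odd b)
    (j : Fin (a + b - 1)) :
    ETWLeftInv a b j ⟨a - 2, by omega⟩ + ETWLeftInv a b j ⟨a - 1, by omega⟩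
      + ETWLeftInv a b j ⟨a, by omega⟩ + ETWLeftInv a b j ⟨a + b - 1, by omega⟩ =
      if (j : ℕ) = a - 1 then 4 else 0 := by
  rw [Nat.odd_iff] at haodd hbodd
  have hj := j.isLt
  have h1 : ETWLeftInv a b j ⟨a - 2, by omega⟩ =
      if (j : ℕ) = a - 1 then 2 else if (j : ℕ) < a then -altSign j else 0 := by
    simp only [ETWLeftInv, altSign]
    split_ifs <;> first | omega | norm_num
  have h2 : ETWLeftInv a b j ⟨a - 1, by omega⟩ =
      if (j : ℕ) = a - 1 then 2 else if (j : ℕ) < a then altSign j else 0 := by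
    simp only [ETWLeftInv, altSign]
    split_ifs <;> first | omega | norm_num
  have h3 : ETWLeftInv a b j ⟨a, by omega⟩ = if (j : ℕ) < a then 0 else -altSign j := by
    simp only [ETWLeftInv, altSign]
    split_ifs <;> first | omega | norm_num
  have h4 : ETWLeftInv a b j ⟨a + b - 1, by omega⟩ = if (j : ℕ) < a then 0 else altSign j := by
    simp only [ETWLeftInv, altSign]
    split_ifs <;> first | omega | norm_num
  rw [h1, h2, h3, h4]
  split_ifs <;> first | omega | ring

lemma ETWLeftInv_mul_ETW {a b : ℕ} (ha : 2 < a) (hb : 2 < b) (haodd : Odd a) (hbodd : Odd b) :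
    ETWLeftInv a b * ETW a b = 1 := by
  ext j p
  have hj := j.isLt
  have hpl := p.isLt
  rw [Matrix.mul_apply, Matrix.one_apply]
  simp only [Fin.ext_iff]
  by_cases hp : (p : ℕ) = a - 1
  · rw [ETW_column_sum_center ha hb _ p hp, ETWLeftInv_center_sum ha hb haodd hbodd, hp]
    split_ifs <;> norm_num
  rw [Nat.odd_iff] at haodd hbodd
  rw [ETW_column_sum ha hb _ p hp]
  by_cases h : (p : ℕ) < a
  · rw [dif_pos h]
    by_cases hja : (j : ℕ) < a
    · by_cases h0 : (p : ℕ) = 0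
      · simp only [ETWLeftInv, altSign, if_pos h0, if_pos hja]
        split_ifs <;> first | omega | norm_num
      · simp only [ETWLeftInv, altSign, if_neg h0, if_pos hja]
        split_ifs <;> first | omega | norm_num
    · simp only [ETWLeftInv, if_neg hja]
      split_ifs <;> first | omega | norm_num
  · rw [dif_neg h]
    by_cases hja : (j : ℕ) < a
    · simp only [ETWLeftInv, if_pos hja]
      split_ifs <;> first | omega | norm_num
    · simp only [ETWLeftInv, altSign, if_neg hja]
      split_ifs <;> first | omega | norm_num

lemma sum_abs_ETWLeftInv_le {a b : ℕ} (hba : 2 * a ≤ b) (j : Fin (a + b - 1)) :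
    ∑ k, |ETWLeftInv a b j k| ≤ b := by
  have hba' : (2 * a : ℝ) ≤ b := by exact_mod_cast hba
  rw [Fin.sum_univ_add]
  by_cases hj : (j : ℕ) < a
  · have h1 : ∀ i : Fin a, |ETWLeftInv a b j (Fin.castAdd b i)| ≤ 2 := by
      intro i
      simp only [ETWLeftInv, if_pos hj]
      split_ifs <;> simp [abs_mul, abs_altSign]
    have h2 : ∀ i : Fin b, |ETWLeftInv a b j (Fin.natAdd a i)| = 0 := by
      intro i
      simp [ETWLeftInv, hj]
    have h3 := Finset.sum_le_sum fun i (_ : i ∈ Finset.univ) => h1 i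
    simp only [Finset.sum_const, Finset.card_univ, Fintype.card_fin, nsmul_eq_mul] at h3
    simp only [h2, Finset.sum_const_zero]
    linarith
  · have h1 : ∀ i : Fin a, |ETWLeftInv a b j (Fin.castAdd b i)| = 0 := by
      intro i
      simp [ETWLeftInv, hj]
    have h2 : ∀ i : Fin b, |ETWLeftInv a b j (Fin.natAdd a i)| = 1 := by
      intro i
      simp only [ETWLeftInv, if_neg hj, Fin.val_natAdd]
      split_ifs
      · omega
      · exact abs_altSign _
      · exact abs_altSign _
    simp [h1, h2]

/-- A vertex potential, alternating in sign, that certifies the lower bound: it peaks at the vertex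
of the `b`-cycle opposite to the common vertex, and its edge sums lie in `[-1, 1]`. -/
noncomputable def ETPotential (s t p : ℕ) : ℝ :=
  altSign (p + t) * (if p < 2 * s + 1 then 1 / 2
    else if p ≤ 2 * s + t then t + 1 / 2 - ((2 * s + t : ℝ) - p)
    else t + 1 / 2 - ((p : ℝ) - (2 * s + t)))

lemma abs_ETPotential_add_succ_le (s t p : ℕ) :
    |ETPotential s t p + ETPotential s t (p + 1)| ≤ 1 := by
  rw [abs_le]
  simp only [ETPotential, altSign]
  rcases lt_trichotomy p (2 * s) with h | rfl | h
  · constructor <;> split_ifs <;> first | omega | norm_num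
  · constructor <;> split_ifs <;> first | omega | (push_cast; linarith) |
      (have : t = 0 := by omega
       subst this; push_cast; linarith)
  · rcases lt_trichotomy p (2 * s + t) with h' | rfl | h'
    · constructor <;> split_ifs <;> first | omega | (push_cast; linarith)
    · constructor <;> split_ifs <;> first | omega | (push_cast; linarith)
    · constructor <;> split_ifs <;> first | omega | (push_cast; linarith)

lemma le_sum_abs_of_mul_ETW_eq_one {a b : ℕ} (ha : 2 < a) (hb : 2 < b)
    (haodd : Odd a) (hbodd : Odd b) {G : Matrix (Fin (a + b - 1)) (Fin (a + b)) ℝ}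
    (hG : G * ETW a b = 1) : ∃ j, (b : ℝ) ≤ ∑ k, |G j k| := by
  obtain ⟨s, rfl⟩ := haodd
  obtain ⟨t, rfl⟩ := hbodd
  let j : Fin (2 * s + 1 + (2 * t + 1) - 1) := ⟨2 * s + t, by omega⟩
  refine ⟨j, ?_⟩
  let y : Fin (2 * s + 1 + (2 * t + 1) - 1) → ℝ := fun p =>
    (if (p : ℕ) = 2 * s + 1 - 1 then 4 else 2) * ETPotential s t p
  have hy : ∀ k, |(ETW (2 * s + 1) (2 * t + 1)).mulVec y k| ≤ 1 := by
    intro k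
    have hk := k.isLt
    have hrow := ETW_row_sum ha hb (ETPotential s t) k
    have : (ETW (2 * s + 1) (2 * t + 1)).mulVec y k = _ :=
      (Finset.sum_congr rfl fun p _ => mul_comm _ _).trans hrow
    rw [this]
    split_ifs with h1 h2 h3
    · exact abs_ETPotential_add_succ_le s t k
    · rw [abs_le]
      simp only [ETPotential, altSign]
      constructor <;> split_ifs <;> first | omega | norm_num
    · have := abs_ETPotential_add_succ_le s t (k - 1)
      rwa [Nat.sub_add_cancel (by omega)] at this
    · have e : 2 * s + 1 + (2 * t + 1) - 2 = 2 * s + 2 * t := by omega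
      rw [abs_le, e]
      simp only [ETPotential, altSign]
      constructor <;> split_ifs <;> first | omega | (push_cast; linarith)
  have hyj : |y j| = ((2 * t + 1 : ℕ) : ℝ) := by
    simp only [y, j, ETPotential, altSign]
    split_ifs <;> first | omega | (push_cast; rw [abs_of_nonneg (by ring_nf; positivity)]; ring)
  calc ((2 * t + 1 : ℕ) : ℝ) = |∑ k, G j k * (ETW (2 * s + 1) (2 * t + 1)).mulVec y k| := by
        rw [← hyj]
        congr 1
        change y j = G.mulVec ((ETW (2 * s + 1) (2 * t + 1)).mulVec y) j
        rw [Matrix.mulVec_mulVec, hG, Matrix.one_mulVec]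
    _ ≤ ∑ k, |G j k * (ETW (2 * s + 1) (2 * t + 1)).mulVec y k| :=
        Finset.abs_sum_le_sum_abs _ _
    _ ≤ ∑ k, |G j k| := Finset.sum_le_sum fun k _ => by
        rw [abs_mul]
        exact mul_le_of_le_one_right (abs_nonneg _) (hy k)

/-- If `a, b > 2` are odd integers with `b > 2a`, then the minimal `(∞,∞)`-norm of a
generalized inverse of the weighted signless incidence matrix `W` of `ET(n, a, b)` is `b`. -/
theorem stmt8 (a b : ℕ) (ha : 2 < a) (hb : 2 < b) (haodd : Odd a) (hbodd : Odd b)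
    (hba : 2 * a < b) :
    IsLeast {r : ℝ | ∃ G : Matrix (Fin (a + b - 1)) (Fin (a + b)) ℝ,
      ETW a b * G * ETW a b = ETW a b ∧ r = matInfNorm G} (b : ℝ) := by
  have hL := ETWLeftInv_mul_ETW ha hb haodd hbodd
  have lower : ∀ G : Matrix (Fin (a + b - 1)) (Fin (a + b)) ℝ,
      ETW a b * G * ETW a b = ETW a b → (b : ℝ) ≤ matInfNorm G := by
    intro G hG
    have hG1 : G * ETW a b = 1 := by
      rw [← hL, ← congrArg (ETWLeftInv a b * ·) hG]
      simp only [← Matrix.mul_assoc, hL, Matrix.one_mul]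
    obtain ⟨j, hj⟩ := le_sum_abs_of_mul_ETW_eq_one ha hb haodd hbodd hG1
    exact hj.trans (le_ciSup (f := fun i => ∑ k, |G i k|) (Set.finite_range _).bddAbove j)
  have hLW : ETW a b * ETWLeftInv a b * ETW a b = ETW a b := by
    rw [Matrix.mul_assoc, hL, Matrix.mul_one]
  constructor
  · refine ⟨ETWLeftInv a b, hLW, (lower _ hLW).antisymm ?_⟩
    have : Nonempty (Fin (a + b - 1)) := ⟨⟨0, by omega⟩⟩
    exact ciSup_le (sum_abs_ETWLeftInv_le hba.le)
  · rintro r ⟨G, hG, rfl⟩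
    exact lower G hG
end

section
/- Let a, b > 2 be integers with a odd and b even, n = a + b − 1. Let W be the weighted signless edge-vertex incidence matrix of the graph ET(n, a, b). Then min { ‖G‖_{∞,∞} : G ∈ ℝ^{n×(n+1)}, W G W = W } = max{2a, a + b}. -/
open Finset in
theorem sum_fin_succ_eq_sum_Icc (N : ℕ) (f : ℕ → ℝ) :
    ∑ k : Fin N, f (k + 1) = ∑ K ∈ Icc 1 N, f K := by
  rw [Fin.sum_univ_eq_sum_range (fun k => f (k + 1)) N, range_eq_Ico, sum_Ico_add']
  rfl

theorem sum_fin_succ_mul_ite {N K : ℕ} (h1 : 1 ≤ K) (hN : K ≤ N) (f : ℕ → ℝ) (c : ℝ) :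
    ∑ k : Fin N, f (k + 1) * (if (k : ℕ) + 1 = K then c else 0) = f K * c := by
  rw [sum_fin_succ_eq_sum_Icc N (fun k => f k * (if k = K then c else 0))]
  simp [h1, hN]

open Finset in
theorem sum_fin_succ_ite_le (N p q : ℕ) (hpq : p ≤ q) {c : ℝ} (hc : 0 ≤ c) :
    ∑ k : Fin N, (if p < (k : ℕ) + 1 ∧ (k : ℕ) + 1 ≤ q then c else 0) ≤ ((q : ℝ) - p) * c := by
  rw [sum_fin_succ_eq_sum_Icc N (fun k => if p < k ∧ k ≤ q then c else 0), ← sum_filter,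
    sum_const, nsmul_eq_mul]
  have h : #((Icc 1 N).filter fun k => p < k ∧ k ≤ q) ≤ q - p := by
    rw [← Nat.card_Ioc]
    exact card_le_card fun k hk => by simp at hk ⊢; tauto
  have h' : (#((Icc 1 N).filter fun k => p < k ∧ k ≤ q) : ℝ) ≤ (q : ℝ) - p := by
    rw [← Nat.cast_sub hpq]; exact_mod_cast h
  exact mul_le_mul_of_nonneg_right h' hc

/-- Multiplying a row vector, indexed by the edges, with `ETW a b`. -/
theorem sum_mul_ETW {a b : ℕ} (ha : 2 < a) (hb : 2 < b) (f : ℕ → ℝ) (j : Fin (a + b - 1)) :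
    ∑ k : Fin (a + b), f (k + 1) * ETW a b k j =
      if (j : ℕ) + 1 < a then (f (if (j : ℕ) = 0 then a else j) + f (j + 1)) / 2
      else if (j : ℕ) + 1 = a then (f (a - 1) + f a + f (a + 1) + f (a + b)) / 4
      else (f (j + 1) + f (j + 2)) / 2 := by
  obtain ⟨j, hj⟩ := j
  dsimp only
  split_ifs with h1 h2 h3
  · subst h2
    trans ∑ k : Fin (a + b), (f (k + 1) * (if (k : ℕ) + 1 = a then (2 : ℝ)⁻¹ else 0) +
        f (k + 1) * (if (k : ℕ) + 1 = 0 + 1 then (2 : ℝ)⁻¹ else 0))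
    · refine Finset.sum_congr rfl fun k _ => ?_
      simp only [ETW]
      grind
    · rw [Finset.sum_add_distrib, sum_fin_succ_mul_ite (by omega) (by omega),
        sum_fin_succ_mul_ite (by omega) (by omega)]
      ring
  · trans ∑ k : Fin (a + b), (f (k + 1) * (if (k : ℕ) + 1 = j then (2 : ℝ)⁻¹ else 0) +
        f (k + 1) * (if (k : ℕ) + 1 = j + 1 then (2 : ℝ)⁻¹ else 0))
    · refine Finset.sum_congr rfl fun k _ => ?_
      simp only [ETW]
      grind
    · rw [Finset.sum_add_distrib, sum_fin_succ_mul_ite (by omega) (by omega),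
        sum_fin_succ_mul_ite (by omega) (by omega)]
      ring
  · trans ∑ k : Fin (a + b), (f (k + 1) * (if (k : ℕ) + 1 = a - 1 then (4 : ℝ)⁻¹ else 0) +
        f (k + 1) * (if (k : ℕ) + 1 = a then (4 : ℝ)⁻¹ else 0) +
        f (k + 1) * (if (k : ℕ) + 1 = a + 1 then (4 : ℝ)⁻¹ else 0) +
        f (k + 1) * (if (k : ℕ) + 1 = a + b then (4 : ℝ)⁻¹ else 0))
    · refine Finset.sum_congr rfl fun k _ => ?_
      simp only [ETW]
      grind
    · rw [Finset.sum_add_distrib, Finset.sum_add_distrib, Finset.sum_add_distrib,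
        sum_fin_succ_mul_ite (by omega) (by omega), sum_fin_succ_mul_ite (by omega) (by omega),
        sum_fin_succ_mul_ite (by omega) (by omega), sum_fin_succ_mul_ite (by omega) (by omega)]
      ring
  · trans ∑ k : Fin (a + b), (f (k + 1) * (if (k : ℕ) + 1 = j + 1 then (2 : ℝ)⁻¹ else 0) +
        f (k + 1) * (if (k : ℕ) + 1 = j + 2 then (2 : ℝ)⁻¹ else 0))
    · refine Finset.sum_congr rfl fun k _ => ?_
      simp only [ETW]
      grind
    · rw [Finset.sum_add_distrib, sum_fin_succ_mul_ite (by omega) (by omega),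
        sum_fin_succ_mul_ite (by omega) (by omega)]
      ring

/-- The row vector (in one-based edge indices) supported on the odd cycle whose signed values at
the edges through `v_J` are `1` and which cancels at all other vertices of that cycle. -/
noncomputable def oddCycleRow (a J K : ℕ) : ℝ :=
  if K ≤ a then (if K < J then (-1) ^ (J + K + 1) else (-1) ^ (J + K)) else 0

/-- The row vector supported on the shorter arc of the even cycle between `v_a` and `v_J`. -/
noncomputable def evenArcRow (a b J K : ℕ) : ℝ :=
  if 2 * J ≤ 2 * a + b then (if a < K ∧ K ≤ J then 2 * (-1) ^ (J + K) else 0)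
  else (if J < K ∧ K ≤ a + b then 2 * (-1) ^ (J + K + 1) else 0)

/-- A left inverse of `ETW a b` of minimal `(∞,∞)`-norm. -/
noncomputable def ETLeftInv (a b : ℕ) : Matrix (Fin (a + b - 1)) (Fin (a + b)) ℝ := fun i k =>
  if (i : ℕ) + 1 < a then oddCycleRow a (i + 1) (k + 1)
  else if (i : ℕ) + 1 = a then 2 * oddCycleRow a a (k + 1)
  else (-1) ^ ((i : ℕ) + 1 + a) * oddCycleRow a a (k + 1) + evenArcRow a b (i + 1) (k + 1)

theorem sum_oddCycleRow_mul_ETW {a b : ℕ} (ha : 2 < a) (hb : 2 < b) (haodd : Odd a)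
    {J : ℕ} (hJ1 : 1 ≤ J) (hJ : J ≤ a) (j : Fin (a + b - 1)) :
    ∑ k : Fin (a + b), oddCycleRow a J (k + 1) * ETW a b k j =
      if (j : ℕ) + 1 = J then (if J = a then 1 / 2 else 1) else 0 := by
  rw [sum_mul_ETW ha hb]
  obtain ⟨j, hj⟩ := j
  obtain ⟨m, rfl⟩ := haodd
  simp only [oddCycleRow]
  have e := neg_one_pow_eq_or ℝ J
  have e' := neg_one_pow_eq_or ℝ j
  have e3 : (-1 : ℝ) ^ (2 * m) = 1 := by simp
  have e4 : (2 * m + 1 - 1) = 2 * m := by omega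
  simp only [e4, pow_add, e3, pow_one, pow_two]
  rcases lt_trichotomy (j + 1) J with h | h | h <;> rcases Nat.eq_zero_or_pos j with h0 | h0 <;>
    subst_vars <;> rcases e' with e' | e' <;> grind

theorem sum_evenArcRow_mul_ETW {a b : ℕ} (ha : 2 < a) (hb : 2 < b) (haodd : Odd a)
    (hbeven : Even b) {J : ℕ} (hJ1 : a < J) (hJ : J < a + b) (j : Fin (a + b - 1)) :
    ∑ k : Fin (a + b), evenArcRow a b J (k + 1) * ETW a b k j =
      if (j : ℕ) + 1 = J then 1 else if (j : ℕ) + 1 = a then - (-1) ^ (J + a) / 2 else 0 := by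
  rw [sum_mul_ETW ha hb]
  obtain ⟨j, hj⟩ := j
  obtain ⟨m, rfl⟩ := haodd
  obtain ⟨l, rfl⟩ := hbeven
  rw [← two_mul] at *
  simp only [evenArcRow]
  have e := neg_one_pow_eq_or ℝ J
  have e' := neg_one_pow_eq_or ℝ j
  have e3 : (-1 : ℝ) ^ (2 * m) = 1 := by simp
  have e6 : (-1 : ℝ) ^ l * (-1) ^ l = 1 := by rw [← mul_pow]; simp
  simp only [pow_add, e3, e6, pow_one, pow_two]
  rcases lt_trichotomy (j + 1) J with h | h | h <;> by_cases h1 : 2 * J ≤ 2 * (2 * m + 1) + 2 * l <;>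
    subst_vars <;> rcases e' with e' | e' <;> grind

theorem ETLeftInv_mul_ETW {a b : ℕ} (ha : 2 < a) (hb : 2 < b) (haodd : Odd a)
    (hbeven : Even b) : ETLeftInv a b * ETW a b = 1 := by
  ext i j
  rw [Matrix.mul_apply, Matrix.one_apply]
  have hij : i = j ↔ (j : ℕ) + 1 = i + 1 := by rw [Fin.ext_iff]; omega
  have hi := i.2
  by_cases h1 : (i : ℕ) + 1 < a
  · simp only [ETLeftInv, if_pos h1, hij]
    rw [sum_oddCycleRow_mul_ETW ha hb haodd (by omega) h1.le, if_neg h1.ne]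
  by_cases h2 : (i : ℕ) + 1 = a
  · simp only [ETLeftInv, if_neg h1, if_pos h2, hij, mul_assoc, ← Finset.mul_sum]
    rw [sum_oddCycleRow_mul_ETW ha hb haodd (by omega) le_rfl]
    simp [h2]
  · simp only [ETLeftInv, if_neg h1, if_neg h2, hij, add_mul, mul_assoc, Finset.sum_add_distrib,
      ← Finset.mul_sum]
    rw [sum_oddCycleRow_mul_ETW ha hb haodd (by omega) le_rfl,
      sum_evenArcRow_mul_ETW ha hb haodd hbeven (by omega) (by omega), if_pos rfl]
    grind

theorem sum_abs_ETLeftInv_le {a b : ℕ} (i : Fin (a + b - 1)) :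
    ∑ k, |ETLeftInv a b i k| ≤ ((max (2 * a) (a + b) : ℕ) : ℝ) := by
  have hi := i.2
  have m1 : (2 * a : ℝ) ≤ ((max (2 * a) (a + b) : ℕ) : ℝ) := by
    exact_mod_cast le_max_left _ _
  have m2 : (a + b : ℝ) ≤ ((max (2 * a) (a + b) : ℕ) : ℝ) := by
    exact_mod_cast le_max_right _ _
  have hodd (J : ℕ) : ∑ k : Fin (a + b), |oddCycleRow a J (k + 1)| ≤ a := by
    refine le_trans (Finset.sum_le_sum fun k _ => ?_)
      ((sum_fin_succ_ite_le (a + b) 0 a (by omega) zero_le_one).trans (by simp))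
    simp only [oddCycleRow]
    split_ifs <;> first | omega | simp
  by_cases h1 : (i : ℕ) + 1 < a
  · simp only [ETLeftInv, if_pos h1]
    have := hodd (i + 1)
    have : (0 : ℝ) ≤ a := by positivity
    linarith
  by_cases h2 : (i : ℕ) + 1 = a
  · simp only [ETLeftInv, if_neg h1, if_pos h2, abs_mul, ← Finset.mul_sum]
    rw [abs_two]
    linarith [hodd a]
  simp only [ETLeftInv, if_neg h1, if_neg h2]
  have heven : ∑ k : Fin (a + b), |evenArcRow a b (i + 1) (k + 1)| ≤ b := by
    by_cases h : 2 * ((i : ℕ) + 1) ≤ 2 * a + b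
    · have h' : (2 * ((i : ℕ) + 1) : ℝ) ≤ 2 * a + b := by exact_mod_cast h
      refine le_trans (Finset.sum_le_sum fun k _ => ?_)
        ((sum_fin_succ_ite_le (a + b) a (i + 1) (by omega) zero_le_two).trans ?_)
      · simp only [evenArcRow, if_pos h]
        split_ifs <;> simp
      · push_cast
        linarith
    · have h' : (2 * a + b : ℝ) ≤ 2 * ((i : ℕ) + 1) := by exact_mod_cast (not_le.mp h).le
      refine le_trans (Finset.sum_le_sum fun k _ => ?_)
        ((sum_fin_succ_ite_le (a + b) (i + 1) (a + b) (by omega) zero_le_two).trans ?_)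
      · simp only [evenArcRow, if_neg h]
        split_ifs <;> simp
      · push_cast
        linarith
  refine (Finset.sum_le_sum fun k _ => abs_add_le _ _).trans ?_
  simp only [Finset.sum_add_distrib, abs_mul, abs_pow, abs_neg, abs_one, one_pow, one_mul]
  linarith [hodd a]

/-- The dual certificate: a vertex vector `y` (in one-based indices) with `|y_u + y_v| ≤ 1` along
every edge of `ET(n, a, b)` and extreme values at `v_a` and `v_{a + b / 2}`. -/
noncomputable def ETDual (a b J : ℕ) : ℝ :=
  if J ≤ a then (-1) ^ J * ((a : ℝ) / 2 - J)
  else - (-1) ^ J * ((a : ℝ) / 2 + min ((J : ℝ) - a) (a + b - J))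

theorem abs_sum_ETW_mul_le {a b : ℕ} (ha : 2 < a) (hb : 2 < b) (haodd : Odd a)
    (hbeven : Even b) (k : Fin (a + b)) :
    |∑ j : Fin (a + b - 1),
      ETW a b k j * ((if (j : ℕ) + 1 = a then 4 else 2) * ETDual a b (j + 1))| ≤ 1 := by
  have key (u v : ℕ) (hu : 1 ≤ u ∧ u ≤ a + b - 1) (hv : 1 ≤ v ∧ v ≤ a + b - 1)
      (hy : |ETDual a b u + ETDual a b v| ≤ 1)
      (h : ∀ j : Fin (a + b - 1), ETW a b k j * (if (j : ℕ) + 1 = a then 4 else 2) =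
        (if (j : ℕ) + 1 = u then 1 else 0) + (if (j : ℕ) + 1 = v then 1 else 0)) :
      |∑ j : Fin (a + b - 1),
        ETW a b k j * ((if (j : ℕ) + 1 = a then 4 else 2) * ETDual a b (j + 1))| ≤ 1 := by
    simp_rw [← mul_assoc, h, mul_comm _ (ETDual a b _), mul_add, Finset.sum_add_distrib]
    rwa [sum_fin_succ_mul_ite hu.1 hu.2, sum_fin_succ_mul_ite hv.1 hv.2, mul_one, mul_one]
  obtain ⟨k, hk⟩ := k
  obtain ⟨m, rfl⟩ := haodd
  obtain ⟨l, rfl⟩ := hbeven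
  have ek := neg_one_pow_eq_or ℝ k
  have e3 : (-1 : ℝ) ^ (2 * m) = 1 := by simp
  have e5 : (-1 : ℝ) ^ (l + l) = 1 := by simp
  by_cases h1 : k + 1 ≤ 2 * m + 1 - 1
  · refine key (k + 1) (k + 2) (by omega) (by omega) ?_ fun j => ?_
    · simp only [ETDual, if_pos (show k + 1 ≤ 2 * m + 1 by omega),
        if_pos (show k + 2 ≤ 2 * m + 1 by omega), pow_succ]
      push_cast
      rw [abs_le]
      constructor <;> rcases ek with ek | ek <;> rw [ek] <;> linarith
    · simp only [ETW]; grind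
  by_cases h2 : k + 1 = 2 * m + 1
  · refine key (2 * m + 1) 1 (by omega) (by omega) ?_ fun j => ?_
    · simp only [ETDual, if_pos le_rfl, if_pos (show 1 ≤ 2 * m + 1 by omega), pow_succ, e3]
      push_cast
      rw [abs_le]
      constructor <;> linarith
    · simp only [ETW]; grind
  by_cases h3 : k + 1 ≤ 2 * m + 1 + (l + l) - 1
  · refine key k (k + 1) (by omega) (by omega) ?_ fun j => ?_
    · have hkk : (k : ℝ) + 1 ≤ 2 * m + 1 + (l + l) := by exact_mod_cast hk
      by_cases h4 : k = 2 * m + 1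
      · subst h4
        have hl : (2 : ℝ) < l + l := by exact_mod_cast hb
        simp only [ETDual, if_pos le_rfl, if_neg (show ¬ 2 * m + 1 + 1 ≤ 2 * m + 1 by omega),
          pow_succ, e3]
        push_cast
        rw [min_eq_left (by linarith), abs_le]
        constructor <;> linarith
      · simp only [ETDual, if_neg (show ¬ k ≤ 2 * m + 1 by omega),
          if_neg (show ¬ k + 1 ≤ 2 * m + 1 by omega), pow_succ]
        push_cast
        rw [abs_le]
        constructor <;> rcases ek with ek | ek <;> rw [ek] <;> grind
    · simp only [ETW]; grind
  · refine key k (2 * m + 1) (by omega) (by omega) ?_ fun j => ?_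
    · obtain rfl : k = 2 * m + (l + l) := by omega
      have hl : (2 : ℝ) < l + l := by exact_mod_cast hb
      simp only [ETDual, if_pos le_rfl, if_neg (show ¬ 2 * m + (l + l) ≤ 2 * m + 1 by omega),
        pow_add, e3, e5, pow_one]
      push_cast
      rw [min_eq_right (by linarith), abs_le]
      constructor <;> linarith
    · simp only [ETW]; grind

theorem abs_le_matInfNorm_of_mul_eq_one {m n : Type*} [Fintype m] [Fintype n] [DecidableEq n]
    {G : Matrix n m ℝ} {W : Matrix m n ℝ} (h : G * W = 1) (x : n → ℝ)
    (hx : ∀ k, |∑ j, W k j * x j| ≤ 1) (i : n) : |x i| ≤ matInfNorm G := by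
  have hxi : x i = ∑ k, G i k * ∑ j, W k j * x j := by
    have := congrFun (Matrix.mulVec_mulVec x G W) i
    rw [h, Matrix.one_mulVec] at this
    exact this.symm
  refine le_trans ?_ (le_ciSup (f := fun i => ∑ j, |G i j|) (Set.finite_range _).bddAbove i)
  rw [hxi]
  refine (Finset.abs_sum_le_sum_abs _ _).trans (Finset.sum_le_sum fun k _ => ?_)
  rw [abs_mul]
  exact mul_le_of_le_one_right (abs_nonneg _) (hx k)

theorem le_matInfNorm_of_mul_ETW_eq_one {a b : ℕ} (ha : 2 < a) (hb : 2 < b) (haodd : Odd a)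
    (hbeven : Even b) {G : Matrix (Fin (a + b - 1)) (Fin (a + b)) ℝ} (h : G * ETW a b = 1) :
    ((max (2 * a) (a + b) : ℕ) : ℝ) ≤ matInfNorm G := by
  have key := abs_le_matInfNorm_of_mul_eq_one h
    (fun j => (if (j : ℕ) + 1 = a then 4 else 2) * ETDual a b (j + 1))
    (abs_sum_ETW_mul_le ha hb haodd hbeven)
  have e : (-1 : ℝ) ^ a = -1 := haodd.neg_one_pow
  rw [Nat.cast_max, max_le_iff]
  constructor
  · refine le_trans (le_abs.mpr (Or.inl ?_)) (key ⟨a - 1, by omega⟩)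
    simp only [show a - 1 + 1 = a by omega, if_pos, ETDual, le_refl, e]
    push_cast
    linarith
  · obtain ⟨l, rfl⟩ := hbeven
    refine le_trans ?_ (key ⟨a + l - 1, by omega⟩)
    simp only [show a + l - 1 + 1 = a + l by omega, if_neg (show ¬ a + l = a by omega),
      if_neg (show ¬ a + l ≤ a by omega), ETDual, pow_add, e]
    push_cast
    rw [show min ((a : ℝ) + l - a) (a + (l + l) - (a + l)) = l by
      rw [min_eq_left (by linarith)]; ring]
    rw [le_abs]
    rcases neg_one_pow_eq_or ℝ l with e' | e' <;> rw [e']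
    · left; linarith
    · right; linarith

/-- If `a, b > 2` are integers with `a` odd and `b` even, then the minimal `(∞,∞)`-norm
of a generalized inverse of the weighted signless incidence matrix `W` of `ET(n, a, b)` is
`max{2a, a + b}`. -/
theorem stmt9 (a b : ℕ) (ha : 2 < a) (hb : 2 < b) (haodd : Odd a) (hbeven : Even b) :
    IsLeast {r : ℝ | ∃ G : Matrix (Fin (a + b - 1)) (Fin (a + b)) ℝ,
      ETW a b * G * ETW a b = ETW a b ∧ r = matInfNorm G} ((max (2 * a) (a + b) : ℕ) : ℝ) := by
  have hL := ETLeftInv_mul_ETW ha hb haodd hbeven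
  have : Nonempty (Fin (a + b - 1)) := ⟨⟨0, by omega⟩⟩
  refine ⟨⟨ETLeftInv a b, by rw [Matrix.mul_assoc, hL, Matrix.mul_one],
    (le_matInfNorm_of_mul_ETW_eq_one ha hb haodd hbeven hL).antisymm
      (ciSup_le sum_abs_ETLeftInv_le)⟩, ?_⟩
  rintro _ ⟨G, hG, rfl⟩
  refine le_matInfNorm_of_mul_ETW_eq_one ha hb haodd hbeven ?_
  calc G * ETW a b = ETLeftInv a b * ETW a b * (G * ETW a b) := by rw [hL, Matrix.one_mul]
    _ = ETLeftInv a b * (ETW a b * G * ETW a b) := by simp only [Matrix.mul_assoc]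
    _ = 1 := by rw [hG, hL]
end

section
/- Let a, b > 2 be integers with a and b both odd, n = a + b − 1, and suppose b ≤ a ≤ 2b. Let W be the weighted signless edge-vertex incidence matrix of ET(n, a, b) and define Y ∈ ℝ^n by: y_i = (−1)^i(b − 2i) for 1 ≤ i ≤ (b−1)/2; y_i = (−1)^{(b−1)/2} for (b+1)/2 ≤ i ≤ a − (b+1)/2; y_i = (−1)^{a−i}(b − 2(a−i)) for a − (b−1)/2 ≤ i ≤ a−1; y_a = 2b; y_i = (−1)^{i−a}(b − 2(i−a)) for a+1 ≤ i ≤ a + (b−1)/2; and y_i = (−1)^{a+b−i}(b − 2(a+b−i)) for a + (b+1)/2 ≤ i ≤ a+b−1. Then ‖Y‖_∞ = 2b, ‖WY‖_∞ = 1, and hence μ_∞(ET(n,a,b)) = min_{‖X‖_∞=1} ‖WX‖_∞ = 1/(2b). -/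
/-- The optimal vector `Y` for `ET(n, a, b)` with `a, b` odd and `b ≤ a ≤ 2b`:
`y_i = (−1)^i (b − 2i)` for `1 ≤ i ≤ (b−1)/2`; `y_i = (−1)^{(b−1)/2}` for
`(b+1)/2 ≤ i ≤ a − (b+1)/2`; `y_i = (−1)^{a−i} (b − 2(a−i))` for
`a − (b−1)/2 ≤ i ≤ a−1`; `y_a = 2b`; `y_i = (−1)^{i−a} (b − 2(i−a))` for
`a+1 ≤ i ≤ a + (b−1)/2`; and `y_i = (−1)^{a+b−i} (b − 2(a+b−i))` for
`a + (b+1)/2 ≤ i ≤ a+b−1`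
(vertex `v_i` corresponds to index `i − 1` in `Fin (a + b - 1)`). -/
noncomputable def Yvec14 (a b : ℕ) : Fin (a + b - 1) → ℝ := fun j =>
  let i : ℕ := (j : ℕ) + 1
  if i ≤ (b - 1) / 2 then (-1 : ℝ) ^ i * ((b : ℝ) - 2 * (i : ℝ))
  else if i ≤ a - (b + 1) / 2 then (-1 : ℝ) ^ ((b - 1) / 2)
  else if i ≤ a - 1 then (-1 : ℝ) ^ (a - i) * ((b : ℝ) - 2 * ((a - i : ℕ) : ℝ))
  else if i = a then 2 * (b : ℝ)
  else if i ≤ a + (b - 1) / 2 then (-1 : ℝ) ^ (i - a) * ((b : ℝ) - 2 * ((i - a : ℕ) : ℝ))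
  else (-1 : ℝ) ^ (a + b - i) * ((b : ℝ) - 2 * ((a + b - i : ℕ) : ℝ))

/-- The entries of `D⁻¹ X` for `ET(n, a, b)`, extended by `0` to all natural indices. -/
noncomputable def degScaled (a b : ℕ) (X : Fin (a + b - 1) → ℝ) (i : ℕ) : ℝ :=
  if h : i < a + b - 1 then (if i + 1 = a then (4 : ℝ)⁻¹ else (2 : ℝ)⁻¹) * X ⟨i, h⟩ else 0

lemma ETW_mulVec_apply {a b : ℕ} (X : Fin (a + b - 1) → ℝ) (k : Fin (a + b)) (u v : ℕ)
    (hu : u < a + b - 1) (hv : v < a + b - 1) (huv : u ≠ v)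
    (h : ∀ j : Fin (a + b - 1), ETW a b k j =
      if (j : ℕ) = u ∨ (j : ℕ) = v then (if (j : ℕ) + 1 = a then (4 : ℝ)⁻¹ else (2 : ℝ)⁻¹) else 0) :
    (ETW a b).mulVec X k = degScaled a b X u + degScaled a b X v := by
  have key : ∀ j : Fin (a + b - 1), ETW a b k j * X j =
      (if j = ⟨u, hu⟩ then degScaled a b X u else 0) +
        (if j = ⟨v, hv⟩ then degScaled a b X v else 0) := by
    intro j
    rw [h j]
    by_cases h1 : (j : ℕ) = u
    · have h2 : (j : ℕ) ≠ v := fun h2 => huv (h1.symm.trans h2)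
      subst h1
      simp [degScaled, Fin.ext_iff, h2]
    · by_cases h2 : (j : ℕ) = v
      · subst h2
        simp [degScaled, Fin.ext_iff, h1]
      · simp [Fin.ext_iff, h1, h2]
  simp only [Matrix.mulVec, dotProduct, key, Finset.sum_add_distrib, Finset.sum_ite_eq',
    Finset.mem_univ, if_true]

lemma ETW_mulVec_left {a b : ℕ} (hb : 2 < b) (X : Fin (a + b - 1) → ℝ) (i : ℕ)
    (hi : i + 1 < a) (hk : i < a + b) :
    (ETW a b).mulVec X ⟨i, hk⟩ = degScaled a b X i + degScaled a b X (i + 1) := by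
  refine ETW_mulVec_apply X _ _ _ (by omega) (by omega) (by omega) fun j => ?_
  have h1 : i + 1 ≤ a - 1 := by omega
  simp [ETW, h1]

lemma ETW_mulVec_left_close {a b : ℕ} (ha : 2 < a) (hb : 2 < b) (X : Fin (a + b - 1) → ℝ)
    (hk : a - 1 < a + b) :
    (ETW a b).mulVec X ⟨a - 1, hk⟩ = degScaled a b X (a - 1) + degScaled a b X 0 := by
  refine ETW_mulVec_apply X _ _ _ (by omega) (by omega) (by omega) fun j => ?_
  have h1 : ¬ a ≤ a - 1 := by omega
  have h2 : a - 1 + 1 = a := by omega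
  have h3 : (j : ℕ) = a - 1 ↔ (j : ℕ) + 1 = a := by omega
  simp only [ETW, h1, h2, h3, if_true, if_false, Nat.add_eq_right]

lemma ETW_mulVec_right {a b : ℕ} (ha : 2 < a) (X : Fin (a + b - 1) → ℝ) (i : ℕ)
    (hi : a ≤ i + 1) (hib : i + 2 < a + b) (hk : i + 1 < a + b) :
    (ETW a b).mulVec X ⟨i + 1, hk⟩ = degScaled a b X i + degScaled a b X (i + 1) := by
  refine ETW_mulVec_apply X _ _ _ (by omega) (by omega) (by omega) fun j => ?_
  have h1 : ¬ i + 1 + 1 ≤ a - 1 := by omega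
  have h2 : ¬ i + 1 + 1 = a := by omega
  have h3 : i + 1 + 1 ≤ a + b - 1 := by omega
  simp only [ETW, h1, h2, h3, if_true, if_false, Nat.add_sub_cancel, Nat.add_right_cancel_iff]

lemma ETW_mulVec_right_close {a b : ℕ} (ha : 2 < a) (hb : 2 < b) (X : Fin (a + b - 1) → ℝ)
    (hk : a + b - 1 < a + b) :
    (ETW a b).mulVec X ⟨a + b - 1, hk⟩ =
      degScaled a b X (a + b - 2) + degScaled a b X (a - 1) := by
  refine ETW_mulVec_apply X _ _ _ (by omega) (by omega) (by omega) fun j => ?_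
  have h1 : ¬ a + b - 1 + 1 ≤ a - 1 := by omega
  have h2 : ¬ a + b - 1 + 1 = a := by omega
  have h3 : ¬ a + b - 1 + 1 ≤ a + b - 1 := by omega
  have h4 : (j : ℕ) = a + b - 2 ↔ (j : ℕ) + 1 = a + b - 1 := by omega
  have h5 : (j : ℕ) = a - 1 ↔ (j : ℕ) + 1 = a := by omega
  simp only [ETW, h1, h2, h3, h4, h5, if_false]

lemma abs_sub_neg_one_pow_mul_le {f : ℕ → ℝ} {r : ℝ} (h : ∀ i, |f i + f (i + 1)| ≤ r)
    (i k : ℕ) : |f i - (-1) ^ k * f (i + k)| ≤ k * r := by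
  induction k with
  | zero => simp
  | succ k ih =>
    have h1 := h (i + k)
    have e : f i - (-1) ^ (k + 1) * f (i + (k + 1)) =
        (f i - (-1) ^ k * f (i + k)) + (-1) ^ k * (f (i + k) + f (i + k + 1)) := by
      rw [← add_assoc]; ring
    have h2 : |(-1 : ℝ) ^ k * (f (i + k) + f (i + k + 1))| ≤ r := by
      simpa [abs_mul] using h1
    rw [e]
    push_cast
    linarith [abs_add_le (f i - (-1) ^ k * f (i + k)) ((-1) ^ k * (f (i + k) + f (i + k + 1)))]

/-- On an odd cycle, a bound on all the edge sums bounds the vertex values. -/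
lemma two_mul_abs_le_of_odd_cycle {m : ℕ} (hm : Odd m) {f : ℕ → ℝ} {r : ℝ}
    (h : ∀ i, i + 1 < m → |f i + f (i + 1)| ≤ r) (hc : |f (m - 1) + f 0| ≤ r)
    {i : ℕ} (hi : i < m) : 2 * |f i| ≤ m * r := by
  have hstep : ∀ j, |f (j % m) + f ((j + 1) % m)| ≤ r := by
    intro j
    have hj : j % m < m := Nat.mod_lt _ (by omega)
    rcases Nat.lt_or_ge (j % m + 1) m with h1 | h1
    · have e : (j + 1) % m = j % m + 1 := by
        rw [← Nat.mod_add_mod, Nat.mod_eq_of_lt h1]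
      rw [e]
      exact h _ h1
    · have e0 : j % m = m - 1 := by omega
      have e : (j + 1) % m = 0 := by
        rw [← Nat.mod_add_mod, e0, Nat.sub_add_cancel (by omega), Nat.mod_self]
      rw [e, e0]
      exact hc
  have := abs_sub_neg_one_pow_mul_le (f := fun j => f (j % m)) hstep i m
  simp only [hm.neg_one_pow, Nat.add_mod_right, Nat.mod_eq_of_lt hi] at this
  have e : f i - -1 * f i = 2 * f i := by ring
  rwa [e, abs_mul, abs_two] at this

lemma norm_le_two_mul_norm_ETW_mulVec {a b : ℕ} (ha : 2 < a) (hb : 2 < b) (haodd : Odd a)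
    (hbodd : Odd b) (hba : b ≤ a) (hab : a ≤ 2 * b) (X : Fin (a + b - 1) → ℝ) :
    ‖X‖ ≤ 2 * b * ‖(ETW a b).mulVec X‖ := by
  set r := ‖(ETW a b).mulVec X‖ with hr
  have hr0 : 0 ≤ r := norm_nonneg _
  have row : ∀ k, |(ETW a b).mulVec X k| ≤ r := fun k => norm_le_pi_norm ((ETW a b).mulVec X) k
  have hA : ∀ i < a, 2 * |degScaled a b X i| ≤ a * r := fun i hi => by
    refine two_mul_abs_le_of_odd_cycle haodd (fun j hj => ?_) ?_ hi
    · rw [← ETW_mulVec_left hb X j hj (by omega)]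
      exact row _
    · rw [← ETW_mulVec_left_close ha hb X (by omega)]
      exact row _
  have hB : ∀ i < b, 2 * |degScaled a b X (a - 1 + i)| ≤ b * r := fun i hi => by
    refine two_mul_abs_le_of_odd_cycle (f := fun j => degScaled a b X (a - 1 + j)) hbodd
      (fun j hj => ?_) ?_ hi
    · have := row ⟨a - 1 + j + 1, by omega⟩
      rwa [ETW_mulVec_right ha X (a - 1 + j) (by omega) (by omega)] at this
    · have := row ⟨a + b - 1, by omega⟩
      rw [ETW_mulVec_right_close ha hb X] at this
      have e : a - 1 + (b - 1) = a + b - 2 := by omega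
      simpa only [e, Nat.add_zero] using this
  have hab' : (a : ℝ) ≤ 2 * b := by exact_mod_cast hab
  have har : a * r ≤ 2 * b * r := mul_le_mul_of_nonneg_right hab' hr0
  have hbr : 0 ≤ b * r := by positivity
  refine (pi_norm_le_iff_of_nonneg (by positivity)).2 fun j => ?_
  rw [Real.norm_eq_abs]
  obtain ⟨j, hj⟩ := j
  by_cases hja : j + 1 = a
  · have h := hB 0 (by omega)
    have e : a - 1 + 0 = j := by omega
    rw [e] at h
    simp only [degScaled, hj, hja, dif_pos, if_true, abs_mul] at h
    norm_num at h
    linarith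
  · have h : 2 * |degScaled a b X j| ≤ 2 * b * r := by
      rcases Nat.lt_or_ge j a with h1 | h1
      · exact (hA j h1).trans har
      · have h := hB (j - (a - 1)) (by omega)
        rw [show a - 1 + (j - (a - 1)) = j by omega] at h
        linarith
    simp only [degScaled, hj, hja, dif_pos, if_false, abs_mul] at h
    norm_num at h
    linarith

section Optimal

variable {a b q : ℕ}

lemma degScaled_Yvec14_left (hbq : b = 2 * q + 1) (hba : b ≤ a) {d : ℕ} (h1 : 1 ≤ d)
    (h2 : d ≤ q) : degScaled a b (Yvec14 a b) (d - 1) = (-1) ^ d * (b - 2 * d) / 2 := by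
  have e : d - 1 + 1 = d := by omega
  have c1 : d ≤ (b - 1) / 2 := by omega
  have c2 : d ≠ a := by omega
  have c3 : d - 1 < a + b - 1 := by omega
  simp only [degScaled, Yvec14, e, c1, c2, c3, dif_pos, if_true, if_false]
  ring

lemma degScaled_Yvec14_middle (hbq : b = 2 * q + 1) {i : ℕ} (h1 : q ≤ i)
    (h2 : i + q + 2 ≤ a) : degScaled a b (Yvec14 a b) i = (-1) ^ q / 2 := by
  have c0 : ¬ i + 1 ≤ (b - 1) / 2 := by omega
  have c1 : i + 1 ≤ a - (b + 1) / 2 := by omega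
  have c2 : i + 1 ≠ a := by omega
  have c3 : i < a + b - 1 := by omega
  have c4 : (b - 1) / 2 = q := by omega
  rw [c4] at c0
  simp only [degScaled, Yvec14, c0, c1, c2, c3, c4, dif_pos, if_true, if_false]
  ring

lemma degScaled_Yvec14_left_end (hbq : b = 2 * q + 1) (hba : b ≤ a) {d : ℕ} (h1 : 1 ≤ d)
    (h2 : d ≤ q) : degScaled a b (Yvec14 a b) (a - d - 1) = (-1) ^ d * (b - 2 * d) / 2 := by
  have e : a - d - 1 + 1 = a - d := by omega
  have c0 : ¬ a - d ≤ (b - 1) / 2 := by omega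
  have c1 : ¬ a - d ≤ a - (b + 1) / 2 := by omega
  have c2 : a - d ≤ a - 1 := by omega
  have c3 : a - d - 1 < a + b - 1 := by omega
  have c4 : a - (a - d) = d := by omega
  have c5 : a - d ≠ a := by omega
  simp only [degScaled, Yvec14, e, c0, c1, c2, c3, c4, c5, dif_pos, if_true, if_false]
  ring

lemma degScaled_Yvec14_center (hbq : b = 2 * q + 1) (hba : b ≤ a) (hq : 1 ≤ q) :
    degScaled a b (Yvec14 a b) (a - 1) = b / 2 := by
  have e : a - 1 + 1 = a := by omega
  have c0 : ¬ a ≤ (b - 1) / 2 := by omega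
  have c1 : ¬ a ≤ a - (b + 1) / 2 := by omega
  have c2 : ¬ a ≤ a - 1 := by omega
  have c3 : a - 1 < a + b - 1 := by omega
  simp only [degScaled, Yvec14, e, c0, c1, c2, c3, dif_pos, if_true, if_false]
  ring

lemma degScaled_Yvec14_right (hbq : b = 2 * q + 1) (hba : b ≤ a) {d : ℕ} (h1 : 1 ≤ d)
    (h2 : d ≤ q) : degScaled a b (Yvec14 a b) (a + d - 1) = (-1) ^ d * (b - 2 * d) / 2 := by
  have e : a + d - 1 + 1 = a + d := by omega
  have c0 : ¬ a + d ≤ (b - 1) / 2 := by omega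
  have c1 : ¬ a + d ≤ a - (b + 1) / 2 := by omega
  have c2 : ¬ a + d ≤ a - 1 := by omega
  have c3 : a + d - 1 < a + b - 1 := by omega
  have c4 : a + d - a = d := by omega
  have c5 : a + d ≠ a := by omega
  have c6 : a + d ≤ a + (b - 1) / 2 := by omega
  simp only [degScaled, Yvec14, e, c0, c1, c2, c3, c4, c5, c6, dif_pos, if_true, if_false]
  ring

lemma degScaled_Yvec14_right_end (hbq : b = 2 * q + 1) (hba : b ≤ a) {d : ℕ} (h1 : 1 ≤ d)
    (h2 : d ≤ q) :
    degScaled a b (Yvec14 a b) (a + b - d - 1) = (-1) ^ d * (b - 2 * d) / 2 := by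
  have e : a + b - d - 1 + 1 = a + b - d := by omega
  have c0 : ¬ a + b - d ≤ (b - 1) / 2 := by omega
  have c1 : ¬ a + b - d ≤ a - (b + 1) / 2 := by omega
  have c2 : ¬ a + b - d ≤ a - 1 := by omega
  have c3 : a + b - d - 1 < a + b - 1 := by omega
  have c4 : a + b - (a + b - d) = d := by omega
  have c5 : a + b - d ≠ a := by omega
  have c6 : ¬ a + b - d ≤ a + (b - 1) / 2 := by omega
  simp only [degScaled, Yvec14, e, c0, c1, c2, c3, c4, c5, c6, dif_pos, if_false]
  ring

lemma abs_alternating_add_succ (c : ℝ) (d : ℕ) :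
    |(-1) ^ d * (c - 2 * d) / 2 + (-1) ^ (d + 1) * (c - 2 * (d + 1 : ℕ)) / 2| = 1 := by
  have e : (-1) ^ d * (c - 2 * d) / 2 + (-1) ^ (d + 1) * (c - 2 * (d + 1 : ℕ)) / 2 =
      (-1 : ℝ) ^ d := by
    push_cast; ring
  rw [e, abs_neg_one_pow]

lemma abs_ETW_mulVec_Yvec14 (hb : 2 < b) (hbodd : Odd b) (hba : b ≤ a) (k : Fin (a + b)) :
    |(ETW a b).mulVec (Yvec14 a b) k| = 1 := by
  obtain ⟨q, hbq⟩ := hbodd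
  have hq : 1 ≤ q := by omega
  have hbR : (b : ℝ) = 2 * q + 1 := by exact_mod_cast hbq
  have hsame : |(-1 : ℝ) ^ q / 2 + (-1) ^ q / 2| = 1 := by
    rw [add_halves, abs_neg_one_pow]
  have htop : (-1 : ℝ) ^ q * (b - 2 * q) / 2 = (-1) ^ q / 2 := by rw [hbR]; ring
  obtain ⟨k, hk⟩ := k
  rcases Nat.lt_or_ge (k + 1) a with h | h
  · rw [ETW_mulVec_left hb _ k h]
    rcases Nat.lt_or_ge (k + 1) q with h1 | h1
    · have e1 := degScaled_Yvec14_left hbq hba (d := k + 1) (by omega) h1.le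
      have e2 := degScaled_Yvec14_left hbq hba (d := k + 2) (by omega) (by omega)
      simp only [Nat.add_sub_cancel, Nat.reduceSubDiff] at e1 e2
      rw [e1, e2]
      exact abs_alternating_add_succ _ _
    · have flat : ∀ i, q ≤ i + 1 → i + q + 1 ≤ a →
          degScaled a b (Yvec14 a b) i = (-1) ^ q / 2 := by
        intro i hi1 hi2
        rcases Nat.lt_or_ge i q with h2 | h2
        · have := degScaled_Yvec14_left hbq hba (d := q) hq le_rfl
          rwa [htop, show q - 1 = i by omega] at this
        · rcases Nat.lt_or_ge (i + q + 1) a with h3 | h3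
          · exact degScaled_Yvec14_middle hbq h2 h3
          · have := degScaled_Yvec14_left_end hbq hba (d := q) hq le_rfl
            rwa [htop, show a - q - 1 = i by omega] at this
      rcases Nat.lt_or_ge (k + q + 1) a with h2 | h2
      · rw [flat k h1 h2.le, flat (k + 1) (by omega) (by omega), hsame]
      · obtain ⟨d, hd⟩ : ∃ d, a = k + 2 + d := ⟨a - (k + 2), by omega⟩
        have e1 := degScaled_Yvec14_left_end hbq hba (d := d + 1) (by omega) (by omega)
        rw [show a - (d + 1) - 1 = k by omega] at e1
        rw [e1]
        rcases Nat.eq_zero_or_pos d with h0 | h0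
        · subst h0
          have e2 := degScaled_Yvec14_center hbq hba hq
          rw [show a - 1 = k + 1 by omega] at e2
          have h1R : (-1) ^ (0 + 1) * (b - 2 * (0 + 1 : ℕ)) / 2 + (b : ℝ) / 2 = 1 := by
            push_cast; ring
          rw [e2, h1R, abs_one]
        · have e2 := degScaled_Yvec14_left_end hbq hba (d := d) h0 (by omega)
          rw [show a - d - 1 = k + 1 by omega] at e2
          rw [e2, add_comm]
          exact abs_alternating_add_succ _ _
  · have h1R : (b : ℝ) / 2 + (-1) ^ 1 * (b - 2 * (1 : ℕ)) / 2 = 1 := by push_cast; ring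
    rcases Nat.lt_or_ge a (k + 1) with h1 | h1
    · rcases Nat.lt_or_ge (k + 1) (a + b) with h2 | h2
      · obtain ⟨k, rfl⟩ : ∃ i, k = i + 1 := ⟨k - 1, by omega⟩
        rw [ETW_mulVec_right (by omega) _ k (by omega) h2]
        obtain ⟨d, hd⟩ : ∃ d, k + 1 = a + d := ⟨k + 1 - a, by omega⟩
        rcases Nat.lt_or_ge d q with h3 | h3
        · have e1 := degScaled_Yvec14_right hbq hba (d := d + 1) (by omega) (by omega)
          rw [show a + (d + 1) - 1 = k + 1 by omega] at e1
          rw [e1]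
          rcases Nat.eq_zero_or_pos d with h0 | h0
          · subst h0
            have e2 := degScaled_Yvec14_center hbq hba hq
            rw [show a - 1 = k by omega] at e2
            rw [e2, h1R, abs_one]
          · have e2 := degScaled_Yvec14_right hbq hba (d := d) h0 (by omega)
            rw [show a + d - 1 = k by omega] at e2
            rw [e2]
            exact abs_alternating_add_succ _ _
        · obtain ⟨d', hd'⟩ : ∃ d', d + d' + 1 = b := ⟨b - d - 1, by omega⟩
          have e1 := degScaled_Yvec14_right_end hbq hba (d := d') (by omega) (by omega)
          rw [show a + b - d' - 1 = k + 1 by omega] at e1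
          rw [e1]
          rcases Nat.eq_or_lt_of_le h3 with h0 | h0
          · have e2 := degScaled_Yvec14_right hbq hba (d := q) hq le_rfl
            rw [show a + q - 1 = k by omega] at e2
            rw [e2, show d' = q by omega, htop, hsame]
          · have e2 := degScaled_Yvec14_right_end hbq hba (d := d' + 1) (by omega) (by omega)
            rw [show a + b - (d' + 1) - 1 = k by omega] at e2
            rw [e2, add_comm]
            exact abs_alternating_add_succ _ _
      · obtain rfl : k = a + b - 1 := by omega
        have e1 := degScaled_Yvec14_right_end hbq hba (d := 1) le_rfl hq
        rw [show a + b - 1 - 1 = a + b - 2 by omega] at e1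
        rw [ETW_mulVec_right_close (by omega) hb, e1, degScaled_Yvec14_center hbq hba hq,
          add_comm, h1R, abs_one]
    · obtain rfl : k = a - 1 := by omega
      have e1 := degScaled_Yvec14_left hbq hba (d := 1) le_rfl hq
      rw [Nat.sub_self] at e1
      rw [ETW_mulVec_left_close (by omega) hb, e1, degScaled_Yvec14_center hbq hba hq, h1R,
        abs_one]

end Optimal

lemma norm_ETW_mulVec_Yvec14 {a b : ℕ} (hb : 2 < b) (hbodd : Odd b) (hba : b ≤ a) :
    ‖(ETW a b).mulVec (Yvec14 a b)‖ = 1 := by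
  refine le_antisymm ((pi_norm_le_iff_of_nonneg zero_le_one).2 fun k => ?_) ?_
  · exact (abs_ETW_mulVec_Yvec14 hb hbodd hba k).le
  · have h := norm_le_pi_norm ((ETW a b).mulVec (Yvec14 a b)) ⟨0, by omega⟩
    rwa [Real.norm_eq_abs, abs_ETW_mulVec_Yvec14 hb hbodd hba] at h

lemma norm_Yvec14 {a b : ℕ} (ha : 2 < a) (hb : 2 < b) (haodd : Odd a) (hbodd : Odd b)
    (hba : b ≤ a) (hab : a ≤ 2 * b) : ‖Yvec14 a b‖ = 2 * (b : ℝ) := by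
  refine le_antisymm ?_ ?_
  · have h := norm_le_two_mul_norm_ETW_mulVec ha hb haodd hbodd hba hab (Yvec14 a b)
    rwa [norm_ETW_mulVec_Yvec14 hb hbodd hba, mul_one] at h
  · obtain ⟨q, hbq⟩ := hbodd
    have hlt : a - 1 < a + b - 1 := by omega
    have e := degScaled_Yvec14_center hbq hba (by omega)
    simp only [degScaled, hlt, dif_pos, Nat.sub_add_cancel (show 1 ≤ a by omega), if_true] at e
    have h := norm_le_pi_norm (Yvec14 a b) ⟨a - 1, hlt⟩
    rw [Real.norm_eq_abs] at h
    linarith [le_abs_self (Yvec14 a b ⟨a - 1, hlt⟩)]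

/-- For `a, b > 2` odd with `b ≤ a ≤ 2b`, the vector `Y` above satisfies `‖Y‖_∞ = 2b`
and `‖WY‖_∞ = 1` for the weighted signless incidence matrix `W` of `ET(n, a, b)`, and
hence `μ_∞(ET(n, a, b)) = min_{‖X‖_∞ = 1} ‖WX‖_∞ = 1/(2b)`. -/
theorem stmt14 (a b : ℕ) (ha : 2 < a) (hb : 2 < b) (haodd : Odd a) (hbodd : Odd b)
    (hba : b ≤ a) (hab : a ≤ 2 * b) :
    ‖Yvec14 a b‖ = 2 * (b : ℝ) ∧ ‖(ETW a b).mulVec (Yvec14 a b)‖ = 1 ∧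
    IsLeast {r : ℝ | ∃ X : Fin (a + b - 1) → ℝ, ‖X‖ = 1 ∧ r = ‖(ETW a b).mulVec X‖}
      (1 / (2 * (b : ℝ))) := by
  have hY := norm_Yvec14 ha hb haodd hbodd hba hab
  have hWY := norm_ETW_mulVec_Yvec14 hb hbodd hba
  have hb0 : 0 < 2 * (b : ℝ) := by positivity
  refine ⟨hY, hWY, ⟨(2 * (b : ℝ))⁻¹ • Yvec14 a b, ?_, ?_⟩, ?_⟩
  · rw [norm_smul, hY, norm_inv, Real.norm_of_nonneg hb0.le, inv_mul_cancel₀ hb0.ne']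
  · rw [Matrix.mulVec_smul, norm_smul, hWY, norm_inv, Real.norm_of_nonneg hb0.le, mul_one,
      one_div]
  · rintro r ⟨X, hX, rfl⟩
    have h := norm_le_two_mul_norm_ETW_mulVec ha hb haodd hbodd hba hab X
    rwa [hX, ← div_le_iff₀' hb0] at h
end

section
/- Let a, b > 2 be integers with a odd, b even, a < b, and n = a + b − 1. Let W be the weighted signless edge-vertex incidence matrix of ET(n, a, b) and define Y ∈ ℝ^n by: y_i = (−1)^i(a − 2i) for 1 ≤ i ≤ (a−1)/2; y_i = (−1)^{a−i}(a − 2(a−i)) for (a+1)/2 ≤ i ≤ a−1; y_a = 2a; y_i = (−1)^{i−a}(a + 2(i−a)) for a+1 ≤ i ≤ a + b/2; and y_i = (−1)^{a+b−i}(a + 2(a+b−i)) for a + b/2 + 1 ≤ i ≤ a+b−1. Then ‖Y‖_∞ = a + b, ‖WY‖_∞ = 1, and hence μ_∞(ET(n,a,b)) = min_{‖X‖_∞=1} ‖WX‖_∞ = 1/(a + b). -/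
/-- The optimal vector `Y` for `ET(n, a, b)` with `a` odd and `b` even:
`y_i = (−1)^i (a − 2i)` for `1 ≤ i ≤ (a−1)/2`; `y_i = (−1)^{a−i} (a − 2(a−i))` for
`(a+1)/2 ≤ i ≤ a−1`; `y_a = 2a`; `y_i = (−1)^{i−a} (a + 2(i−a))` for
`a+1 ≤ i ≤ a + b/2`; and `y_i = (−1)^{a+b−i} (a + 2(a+b−i))` for
`a + b/2 + 1 ≤ i ≤ a+b−1`
(vertex `v_i` corresponds to index `i − 1` in `Fin (a + b - 1)`). -/
noncomputable def YvecEven (a b : ℕ) : Fin (a + b - 1) → ℝ := fun j =>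
  let i : ℕ := (j : ℕ) + 1
  if i ≤ (a - 1) / 2 then (-1 : ℝ) ^ i * ((a : ℝ) - 2 * (i : ℝ))
  else if i ≤ a - 1 then (-1 : ℝ) ^ (a - i) * ((a : ℝ) - 2 * ((a - i : ℕ) : ℝ))
  else if i = a then 2 * (a : ℝ)
  else if i ≤ a + b / 2 then (-1 : ℝ) ^ (i - a) * ((a : ℝ) + 2 * ((i - a : ℕ) : ℝ))
  else (-1 : ℝ) ^ (a + b - i) * ((a : ℝ) + 2 * ((a + b - i : ℕ) : ℝ))

/-- The weighted entries `x_i / d_i` of a vector on the vertices `v_1, …, v_{a+b-1}` of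
`ET(n, a, b)`, extended by zero to all natural indices. -/
noncomputable def weightedEntry (a b : ℕ) (X : Fin (a + b - 1) → ℝ) (i : ℕ) : ℝ :=
  ∑ j : Fin (a + b - 1), if (j : ℕ) + 1 = i then (if i = a then (4 : ℝ)⁻¹ else 2⁻¹) * X j else 0

theorem weightedEntry_succ {a b : ℕ} (X : Fin (a + b - 1) → ℝ) (j : Fin (a + b - 1)) :
    weightedEntry a b X (j + 1) = (if (j : ℕ) + 1 = a then (4 : ℝ)⁻¹ else 2⁻¹) * X j := by
  simp [weightedEntry, ← Fin.ext_iff]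

theorem ETW_mulVec {a b u v : ℕ} (X : Fin (a + b - 1) → ℝ) (k : Fin (a + b)) (huv : u ≠ v)
    (hu : u = if (k : ℕ) + 1 ≤ a - 1 then (k : ℕ) + 1 else if (k : ℕ) + 1 = a then a
      else if (k : ℕ) + 1 ≤ a + b - 1 then (k : ℕ) else a + b - 1)
    (hv : v = if (k : ℕ) + 1 ≤ a - 1 then (k : ℕ) + 2 else if (k : ℕ) + 1 = a then 1
      else if (k : ℕ) + 1 ≤ a + b - 1 then (k : ℕ) + 1 else a) :
    (ETW a b).mulVec X k = weightedEntry a b X u + weightedEntry a b X v := by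
  simp only [Matrix.mulVec, dotProduct, weightedEntry, ← Finset.sum_add_distrib]
  refine Finset.sum_congr rfl fun j _ => ?_
  simp only [ETW, Nat.add_sub_cancel]
  rw [← hu, ← hv]
  by_cases h₁ : (j : ℕ) + 1 = u
  · have h₂ : (j : ℕ) + 1 ≠ v := fun h => huv (h₁.symm.trans h)
    subst h₁
    simp [h₂]
  · by_cases h₂ : (j : ℕ) + 1 = v
    · subst h₂
      simp [h₁]
    · simp [h₁, h₂]

theorem ETW_mulVec_path {a b k : ℕ} (ha : 2 < a) (X : Fin (a + b - 1) → ℝ)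
    (hk : 1 ≤ k) (hkn : k + 1 ≤ a + b - 1) :
    ∃ e, (ETW a b).mulVec X e = weightedEntry a b X k + weightedEntry a b X (k + 1) := by
  by_cases h : k < a
  · exact ⟨⟨k - 1, by omega⟩, ETW_mulVec X _ (by omega) (by simp only; split_ifs <;> omega)
      (by simp only; split_ifs <;> omega)⟩
  · exact ⟨⟨k, by omega⟩, ETW_mulVec X _ (by omega) (by simp only; split_ifs <;> omega)
      (by simp only; split_ifs <;> omega)⟩

theorem ETW_mulVec_closing_first {a b : ℕ} (ha : 2 < a) (X : Fin (a + b - 1) → ℝ) :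
    ∃ e, (ETW a b).mulVec X e = weightedEntry a b X a + weightedEntry a b X 1 :=
  ⟨⟨a - 1, by omega⟩, ETW_mulVec X _ (by omega) (by simp only; split_ifs <;> omega)
      (by simp only; split_ifs <;> omega)⟩

theorem ETW_mulVec_closing_second {a b : ℕ} (hb : 2 < b) (X : Fin (a + b - 1) → ℝ) :
    ∃ e, (ETW a b).mulVec X e =
      weightedEntry a b X (a + b - 1) + weightedEntry a b X a :=
  ⟨⟨a + b - 1, by omega⟩, ETW_mulVec X _ (by omega) (by simp only; split_ifs <;> omega)
      (by simp only; split_ifs <;> omega)⟩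

/-- Every row of `W X` is a sum of the weighted entries at the two ends of an edge. -/
theorem norm_ETW_mulVec_le {a b : ℕ} (ha : 2 < a) (hb : 2 < b) (X : Fin (a + b - 1) → ℝ) {r : ℝ}
    (hr : 0 ≤ r)
    (hpath : ∀ k, 1 ≤ k → k + 1 ≤ a + b - 1 →
      |weightedEntry a b X k + weightedEntry a b X (k + 1)| ≤ r)
    (hfirst : |weightedEntry a b X a + weightedEntry a b X 1| ≤ r)
    (hsecond : |weightedEntry a b X (a + b - 1) + weightedEntry a b X a| ≤ r) :
    ‖(ETW a b).mulVec X‖ ≤ r := by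
  rw [pi_norm_le_iff_of_nonneg hr]
  intro k
  rw [Real.norm_eq_abs]
  have hk := k.isLt
  by_cases h₁ : (k : ℕ) + 1 < a
  · rw [ETW_mulVec X k (u := k + 1) (v := k + 2) (by omega) (by split_ifs <;> omega)
      (by split_ifs <;> omega)]
    exact hpath _ (by omega) (by omega)
  by_cases h₂ : (k : ℕ) + 1 = a
  · rw [ETW_mulVec X k (u := a) (v := 1) (by omega) (by split_ifs <;> omega)
      (by split_ifs <;> omega)]
    exact hfirst
  by_cases h₃ : (k : ℕ) + 1 ≤ a + b - 1
  · rw [ETW_mulVec X k (u := k) (v := k + 1) (by omega) (by split_ifs <;> omega)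
      (by split_ifs <;> omega)]
    exact hpath _ (by omega) h₃
  · rw [ETW_mulVec X k (u := a + b - 1) (v := a) (by omega) (by split_ifs <;> omega)
      (by split_ifs <;> omega)]
    exact hsecond

theorem abs_sub_alternating_le {f : ℕ → ℝ} {r : ℝ} {s : ℕ} (d : ℕ)
    (h : ∀ k, s ≤ k → k < s + d → |f k + f (k + 1)| ≤ r) :
    |f (s + d) - (-1) ^ d * f s| ≤ d * r := by
  induction d with
  | zero => simp
  | succ d ih =>
    have h₁ := ih fun k hk hkd => h k hk (by omega)
    have h₂ := h (s + d) (by omega) (by omega)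
    have h₃ : f (s + (d + 1)) - (-1) ^ (d + 1) * f s =
        (f (s + d) + f (s + d + 1)) - (f (s + d) - (-1) ^ d * f s) := by
      rw [← add_assoc]; ring
    rw [h₃]
    push_cast
    linarith [abs_sub (f (s + d) + f (s + d + 1)) (f (s + d) - (-1) ^ d * f s)]

theorem abs_abs_sub_abs_le_of_path {f : ℕ → ℝ} {r : ℝ} {s t : ℕ} (hst : s ≤ t)
    (h : ∀ k, s ≤ k → k < t → |f k + f (k + 1)| ≤ r) :
    |(|f t| - |f s|)| ≤ ((t : ℝ) - s) * r := by
  obtain ⟨d, rfl⟩ := Nat.exists_eq_add_of_le hst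
  have h₁ := abs_abs_sub_abs_le (f (s + d)) ((-1) ^ d * f s)
  rw [abs_mul, abs_neg_one_pow, one_mul] at h₁
  push_cast
  simpa using h₁.trans (abs_sub_alternating_le d h)

/-- The lower bound for `‖W X‖_∞`: the odd cycle controls the entry at `v_a`, and the distance
to `v_a` controls the others. -/
theorem norm_le_mul_norm_ETW_mulVec {a b : ℕ} (ha : 2 < a) (hb : 2 < b) (haodd : Odd a)
    (hab : a < b) (X : Fin (a + b - 1) → ℝ) :
    ‖X‖ ≤ ((a : ℝ) + b) * ‖(ETW a b).mulVec X‖ := by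
  set r := ‖(ETW a b).mulVec X‖
  have hr0 : 0 ≤ r := norm_nonneg _
  have hrow : ∀ e, |(ETW a b).mulVec X e| ≤ r := norm_le_pi_norm ((ETW a b).mulVec X)
  set z := weightedEntry a b X with hz
  have hpath : ∀ k, 1 ≤ k → k + 1 ≤ a + b - 1 → |z k + z (k + 1)| ≤ r := by
    intro k hk hkn
    obtain ⟨e, he⟩ := ETW_mulVec_path ha X hk hkn
    exact he ▸ hrow e
  have hfirst : |z a + z 1| ≤ r := by
    obtain ⟨e, he⟩ := ETW_mulVec_closing_first (b := b) ha X
    exact he ▸ hrow e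
  have hsecond : |z (a + b - 1) + z a| ≤ r := by
    obtain ⟨e, he⟩ := ETW_mulVec_closing_second hb X
    exact he ▸ hrow e
  have habR : (a : ℝ) < b := by exact_mod_cast hab
  have hmid : 2 * |z a| ≤ a * r := by
    have h := abs_sub_alternating_le (f := z) (r := r) (s := 1) (a - 1)
      fun k hk hka => hpath k hk (by omega)
    have hev : Even (a - 1) := haodd.tsub_odd odd_one
    rw [show 1 + (a - 1) = a by omega, hev.neg_one_pow, one_mul, Nat.cast_sub (by omega)] at h
    push_cast at h
    calc 2 * |z a| = |(z a + z 1) + (z a - z 1)| := by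
          rw [← abs_two, ← abs_mul]; ring_nf
      _ ≤ |z a + z 1| + |z a - z 1| := abs_add_le _ _
      _ ≤ a * r := by linarith
  have hdiff₁ : |z 1| ≤ |z a| + r := by
    have h := abs_abs_sub_abs_le (z 1) (-z a)
    rw [abs_neg, sub_neg_eq_add, add_comm] at h
    linarith [le_abs_self (|z 1| - |z a|)]
  have hdiff₂ : |z (a + b - 1)| ≤ |z a| + r := by
    have h := abs_abs_sub_abs_le (z (a + b - 1)) (-z a)
    rw [abs_neg, sub_neg_eq_add] at h
    linarith [le_abs_self (|z (a + b - 1)| - |z a|)]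
  rw [pi_norm_le_iff_of_nonneg (by positivity)]
  intro j
  rw [Real.norm_eq_abs]
  have hj := j.isLt
  have hzj := weightedEntry_succ X j
  rw [← hz] at hzj
  generalize hi : (j : ℕ) + 1 = i at hzj
  have hgap : 0 ≤ (b - a : ℝ) * r := mul_nonneg (by linarith) hr0
  by_cases hia : i = a
  · rw [if_pos hia, hia] at hzj
    have hX : |X j| = 4 * |z a| := by
      rw [hzj, abs_mul, abs_of_pos (by norm_num : (0 : ℝ) < 4⁻¹)]; ring
    linarith
  rw [if_neg hia] at hzj
  have hX : |X j| = 2 * |z i| := by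
    rw [hzj, abs_mul, abs_of_pos (by norm_num : (0 : ℝ) < 2⁻¹)]; ring
  rw [hX]
  rcases lt_or_gt_of_ne hia with hlt | hgt
  · have h₁ := abs_le.1 <| abs_abs_sub_abs_le_of_path (f := z) (r := r) (s := i) (t := a) hlt.le
      fun k hk hka => hpath k (by omega) (by omega)
    have h₂ := abs_le.1 <| abs_abs_sub_abs_le_of_path (f := z) (r := r) (s := 1) (t := i)
      (by omega) fun k hk hka => hpath k (by omega) (by omega)
    push_cast at h₂
    linarith [h₁.1, h₂.2]
  · have h₁ := abs_le.1 <| abs_abs_sub_abs_le_of_path (f := z) (r := r) (s := a) (t := i) hgt.le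
      fun k hk hka => hpath k (by omega) (by omega)
    have h₂ := abs_le.1 <| abs_abs_sub_abs_le_of_path (f := z) (r := r) (s := i)
      (t := a + b - 1) (by omega) fun k hk hka => hpath k (by omega) (by omega)
    rw [Nat.cast_sub (by omega)] at h₂
    push_cast at h₂
    linarith [h₁.2, h₂.1]

theorem weightedEntry_YvecEven {a b i : ℕ} (hi : 1 ≤ i) (hin : i ≤ a + b - 1) :
    weightedEntry a b (YvecEven a b) i =
      if i ≤ (a - 1) / 2 then (-1 : ℝ) ^ i * ((a - 2 * i) / 2)
      else if i ≤ a then (-1 : ℝ) ^ (a - i) * ((a - 2 * ((a - i : ℕ) : ℝ)) / 2)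
      else if i ≤ a + b / 2 then (-1 : ℝ) ^ (i - a) * ((a + 2 * ((i - a : ℕ) : ℝ)) / 2)
      else (-1 : ℝ) ^ (a + b - i) * ((a + 2 * ((a + b - i : ℕ) : ℝ)) / 2) := by
  obtain ⟨j, rfl⟩ := Nat.exists_eq_add_of_le' hi
  rw [weightedEntry_succ (YvecEven a b) ⟨j, by omega⟩]
  simp only [YvecEven]
  by_cases h : j + 1 = a
  · subst h
    rw [if_pos rfl, if_neg (by omega), if_neg (by omega), if_pos rfl, if_neg (by omega),
      if_pos le_rfl]
    simp
    ring
  · rw [if_neg h, if_neg h]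
    simp only [show j + 1 ≤ a - 1 ↔ j + 1 ≤ a by omega]
    split_ifs <;> ring

/-- Adjacent entries of opposite sign whose absolute values differ by one sum to `±1`. -/
theorem abs_alternating_add_eq_one (j : ℕ) {x y : ℝ} (h : |x - y| = 1) :
    |(-1 : ℝ) ^ j * x + (-1) ^ (j + 1) * y| = 1 := by
  rw [show (-1 : ℝ) ^ j * x + (-1) ^ (j + 1) * y = (-1) ^ j * (x - y) by ring, abs_mul,
    abs_neg_one_pow, one_mul, h]

theorem norm_ETW_mulVec_YvecEven_le {a b : ℕ} (ha : 2 < a) (hb : 2 < b) (haodd : Odd a)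
    (hbeven : Even b) : ‖(ETW a b).mulVec (YvecEven a b)‖ ≤ 1 := by
  obtain ⟨m, hm⟩ := haodd
  obtain ⟨l, hl⟩ := hbeven
  refine norm_ETW_mulVec_le ha hb _ zero_le_one (fun k hk hkn => ?_) ?_ ?_
  · rw [weightedEntry_YvecEven hk (by omega), weightedEntry_YvecEven (by omega) hkn]
    by_cases h₁ : k < m
    · rw [if_pos (by omega), if_pos (by omega)]
      exact (abs_alternating_add_eq_one _ (by push_cast; ring_nf; norm_num)).le
    by_cases h₂ : k = m
    · rw [if_pos (by omega), if_neg (by omega), if_pos (by omega),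
        show a - (k + 1) = k by omega, ← mul_add, abs_mul, abs_neg_one_pow, hm, h₂]
      push_cast
      ring_nf
      norm_num
    by_cases h₃ : k < a
    · rw [if_neg (by omega), if_pos (by omega), if_neg (by omega), if_pos (by omega),
        show a - k = a - (k + 1) + 1 by omega, add_comm]
      exact (abs_alternating_add_eq_one _ (by push_cast; ring_nf; norm_num)).le
    by_cases h₄ : k = a
    · subst h₄
      rw [if_neg (by omega), if_pos (by omega), if_neg (by omega), if_neg (by omega),
        if_pos (by omega), Nat.sub_self, Nat.add_sub_cancel_left]
      exact (abs_alternating_add_eq_one 0 (by push_cast; ring_nf; norm_num)).le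
    by_cases h₅ : k < a + l
    · rw [if_neg (by omega), if_neg (by omega), if_pos (by omega), if_neg (by omega),
        if_neg (by omega), if_pos (by omega), show k + 1 - a = k - a + 1 by omega]
      exact (abs_alternating_add_eq_one _ (by push_cast; ring_nf; norm_num)).le
    by_cases h₆ : k = a + l
    · rw [if_neg (by omega), if_neg (by omega), if_pos (by omega), if_neg (by omega),
        if_neg (by omega), if_neg (by omega),
        show k - a = a + b - (k + 1) + 1 by omega, add_comm]
      exact (abs_alternating_add_eq_one _ (by push_cast; ring_nf; norm_num)).le
    · rw [if_neg (by omega), if_neg (by omega), if_neg (by omega), if_neg (by omega),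
        if_neg (by omega), if_neg (by omega),
        show a + b - k = a + b - (k + 1) + 1 by omega, add_comm]
      exact (abs_alternating_add_eq_one _ (by push_cast; ring_nf; norm_num)).le
  · rw [weightedEntry_YvecEven (by omega) (by omega), weightedEntry_YvecEven le_rfl (by omega),
      if_neg (by omega), if_pos le_rfl, if_pos (by omega), Nat.sub_self]
    exact (abs_alternating_add_eq_one 0 (by push_cast; ring_nf; norm_num)).le
  · rw [weightedEntry_YvecEven (by omega) le_rfl, weightedEntry_YvecEven (by omega) (by omega),
      if_neg (by omega), if_neg (by omega), if_neg (by omega), if_neg (by omega),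
      if_pos le_rfl, Nat.sub_self, show a + b - (a + b - 1) = 1 by omega, add_comm]
    exact (abs_alternating_add_eq_one 0 (by push_cast; ring_nf; norm_num)).le

theorem le_norm_YvecEven {a b : ℕ} (ha : 2 < a) (hb : 2 < b) (hbeven : Even b) :
    (a : ℝ) + b ≤ ‖YvecEven a b‖ := by
  obtain ⟨l, hl⟩ := hbeven
  refine le_trans (le_of_eq ?_)
    (norm_le_pi_norm (YvecEven a b) ⟨a + l - 1, by omega⟩)
  rw [Real.norm_eq_abs]
  simp only [YvecEven]
  rw [show a + l - 1 + 1 = a + l by omega, if_neg (by omega), if_neg (by omega),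
    if_neg (by omega), if_pos (by omega), Nat.add_sub_cancel_left, abs_mul, abs_neg_one_pow,
    one_mul, abs_of_nonneg (by positivity), hl]
  push_cast
  ring

/-- For `a, b > 2` with `a` odd, `b` even and `a < b`, the vector `Y` above satisfies
`‖Y‖_∞ = a + b` and `‖WY‖_∞ = 1` for the weighted signless incidence matrix `W` of
`ET(n, a, b)`, and hence `μ_∞(ET(n, a, b)) = min_{‖X‖_∞ = 1} ‖WX‖_∞ = 1/(a + b)`. -/
theorem stmt16 (a b : ℕ) (ha : 2 < a) (hb : 2 < b) (haodd : Odd a) (hbeven : Even b)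
    (hab : a < b) :
    ‖YvecEven a b‖ = (a : ℝ) + (b : ℝ) ∧ ‖(ETW a b).mulVec (YvecEven a b)‖ = 1 ∧
    IsLeast {r : ℝ | ∃ X : Fin (a + b - 1) → ℝ, ‖X‖ = 1 ∧ r = ‖(ETW a b).mulVec X‖}
      (1 / ((a : ℝ) + (b : ℝ))) := by
  have hs : (0 : ℝ) < (a : ℝ) + b := by positivity
  have hbound := norm_le_mul_norm_ETW_mulVec ha hb haodd hab
  have hWle := norm_ETW_mulVec_YvecEven_le ha hb haodd hbeven
  have hYle := le_norm_YvecEven ha hb hbeven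
  have hY : ‖YvecEven a b‖ = (a : ℝ) + b :=
    le_antisymm ((hbound _).trans (mul_le_of_le_one_right hs.le hWle)) hYle
  have hW : ‖(ETW a b).mulVec (YvecEven a b)‖ = 1 :=
    le_antisymm hWle <| le_of_mul_le_mul_left
      (by rw [mul_one]; exact hYle.trans (hbound _)) hs
  refine ⟨hY, hW, ⟨((a : ℝ) + b)⁻¹ • YvecEven a b, ?_, ?_⟩, ?_⟩
  · rw [norm_smul, hY, norm_inv, Real.norm_of_nonneg hs.le, inv_mul_cancel₀ hs.ne']
  · rw [Matrix.mulVec_smul, norm_smul, hW, norm_inv, Real.norm_of_nonneg hs.le, mul_one, one_div]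
  · rintro _ ⟨X, hX, rfl⟩
    rw [div_le_iff₀' hs, ← hX]
    exact hbound X
end
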